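/- The soundness theorem fails for the full logic L1^l: there exist a labeled protocol Π and a closed formula φ of L1^l such that the label-erased protocol |Π| satisfies the label-erased formula |φ|, but Π does not satisfy φ. Concretely, this is witnessed by the two-role protocol Π with Π(1) = (init, {⟨X^1_{A1}, ⟨{X^1_{A1}}_{ek(A3)}^{ag(1)}, {X^1_{A1}}_{ek(A3)}^{ag(2)}⟩⟩}_{ek(A2)}^{ag(3)}) and Π(2) = ({⟨X^1_{A1}, ⟨C^1_{A2}, C^2_{A2}⟩⟩}_{ek(A2)}^L, stop), where C^1_{A2}, C^2_{A2} are ciphertext variables, and the formula φ1(tr) = ∀LS_{1,2}(tr) ς. ∀LS_{2,2}(tr) ς'. (NC(tr, ς(A1)) ∧ NC(tr, ς(A2)) ∧ (ς(X^1_{A1}) = ς'(X^1_{A1}))) → (ς'(C^1_{A2}) = ς'(C^2_{A2})). -/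

import Mathlib

set_option linter.unusedVariables false

namespace Proto

/-- Labels: label variables, agent labels `ag i`, adversary labels `adv j`. -/
inductive Label where
  | lvar : ℕ → Label
  | ag : ℕ → Label
  | adv : ℕ → Label
deriving DecidableEq

/-- Sorted object-level variables: agent variables `A_i`, nonce variables
`X^j_{A_i}`, ciphertext variables and signature variables. -/
inductive Var where
  | agentV : ℕ → Var
  | nonceV : ℕ → ℕ → Var
  | cipherV : ℕ → Var
  | sigV : ℕ → Var
deriving DecidableEq

/-- Agent expressions occurring in key positions: identities or agent variables. -/
inductive AgentE where
  | const : ℕ → AgentE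
  | avar : ℕ → AgentE
deriving DecidableEq

/-- Terms.  Labeled terms `T^l` are all terms; unlabeled terms `T` are identified
with the label-free ones (all encryption/signature labels equal to `none`). -/
inductive Term where
  | var : Var → Term
  | agent : ℕ → Term
  | ek : AgentE → Term
  | dk : AgentE → Term
  | sk : AgentE → Term
  | vk : AgentE → Term
  | nonce : ℕ → ℕ → ℕ → Term          -- n(a, j, s)
  | pair : Term → Term → Term
  | enc : AgentE → Term → Option Label → Term   -- {m}_{ek(a)}^ℓ
  | sign : AgentE → Term → Option Label → Term  -- [m]_{sk(a)}^ℓ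
deriving DecidableEq

/-- The erasure map `|·|` : removes all labels and commutes with every other
constructor. -/
def erase : Term → Term
  | .var x => .var x
  | .agent a => .agent a
  | .ek a => .ek a
  | .dk a => .dk a
  | .sk a => .sk a
  | .vk a => .vk a
  | .nonce a j s => .nonce a j s
  | .pair t₁ t₂ => .pair (erase t₁) (erase t₂)
  | .enc a t _ => .enc a (erase t) none
  | .sign a t _ => .sign a (erase t) none

/-- Simple terms: agent variables, nonce variables, agent identities, nonces. -/
inductive Term.Simple : Term → Prop
  | agv (i : ℕ) : Term.Simple (.var (.agentV i))
  | nov (i j : ℕ) : Term.Simple (.var (.nonceV i j))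
  | agent (a : ℕ) : Term.Simple (.agent a)
  | nonce (a j s : ℕ) : Term.Simple (.nonce a j s)

/-- A term contains an encryption or a signature subterm. -/
inductive HasCrypt : Term → Prop
  | enc (a : AgentE) (t : Term) (l : Option Label) : HasCrypt (.enc a t l)
  | sign (a : AgentE) (t : Term) (l : Option Label) : HasCrypt (.sign a t l)
  | pairL {t₁ : Term} (t₂ : Term) : HasCrypt t₁ → HasCrypt (.pair t₁ t₂)
  | pairR (t₁ : Term) {t₂ : Term} : HasCrypt t₂ → HasCrypt (.pair t₁ t₂)

/-- The labeled Dolev-Yao deduction relation `S ⊢ˡ m`. -/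
inductive LDeduce : Set Term → Term → Prop
  | mem {S : Set Term} {m : Term} : m ∈ S → LDeduce S m
  | agentK (S : Set Term) (b : ℕ) : LDeduce S (.agent b)
  | ekK (S : Set Term) (b : ℕ) : LDeduce S (.ek (.const b))
  | vkK (S : Set Term) (b : ℕ) : LDeduce S (.vk (.const b))
  | pairI {S m₁ m₂} : LDeduce S m₁ → LDeduce S m₂ → LDeduce S (.pair m₁ m₂)
  | fstE {S m₁ m₂} : LDeduce S (.pair m₁ m₂) → LDeduce S m₁
  | sndE {S m₁ m₂} : LDeduce S (.pair m₁ m₂) → LDeduce S m₂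
  | encI {S b m} (i : ℕ) : LDeduce S (.ek b) → LDeduce S m →
      LDeduce S (.enc b m (some (.adv i)))
  | decI {S b m l} : LDeduce S (.enc b m l) → LDeduce S (.dk b) → LDeduce S m
  | signI {S b m} (i : ℕ) : LDeduce S (.sk b) → LDeduce S m →
      LDeduce S (.sign b m (some (.adv i)))
  | signE {S b m l} : LDeduce S (.sign b m l) → LDeduce S m

/-- The unlabeled Dolev-Yao deduction relation `S ⊢ m` (same rules, labels removed). -/
inductive UDeduce : Set Term → Term → Prop
  | mem {S : Set Term} {m : Term} : m ∈ S → UDeduce S m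
  | agentK (S : Set Term) (b : ℕ) : UDeduce S (.agent b)
  | ekK (S : Set Term) (b : ℕ) : UDeduce S (.ek (.const b))
  | vkK (S : Set Term) (b : ℕ) : UDeduce S (.vk (.const b))
  | pairI {S m₁ m₂} : UDeduce S m₁ → UDeduce S m₂ → UDeduce S (.pair m₁ m₂)
  | fstE {S m₁ m₂} : UDeduce S (.pair m₁ m₂) → UDeduce S m₁
  | sndE {S m₁ m₂} : UDeduce S (.pair m₁ m₂) → UDeduce S m₂
  | encI {S b m} : UDeduce S (.ek b) → UDeduce S m → UDeduce S (.enc b m none)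
  | decI {S b m l} : UDeduce S (.enc b m l) → UDeduce S (.dk b) → UDeduce S m
  | signI {S b m} : UDeduce S (.sk b) → UDeduce S m → UDeduce S (.sign b m none)
  | signE {S b m l} : UDeduce S (.sign b m l) → UDeduce S m

/-- Sort-respecting (partial) substitutions: agent variables go to identities,
nonce variables to nonces `n(a,j,s)`, ciphertext/signature variables to terms,
label variables to labels. -/
structure Subst where
  agv : ℕ → Option ℕ
  nov : ℕ → ℕ → Option (ℕ × ℕ × ℕ)
  civ : ℕ → Option Term
  siv : ℕ → Option Term
  lbv : ℕ → Option Label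

def Subst.applyA (σ : Subst) : AgentE → AgentE
  | .const a => .const a
  | .avar i =>
    match σ.agv i with
    | some a => .const a
    | none => .avar i

def Subst.applyLb (σ : Subst) : Option Label → Option Label
  | some (.lvar n) =>
    match σ.lbv n with
    | some l => some l
    | none => some (.lvar n)
  | l => l

/-- Homomorphic application of a substitution to a term. -/
def Subst.apply (σ : Subst) : Term → Term
  | .var (.agentV i) =>
    match σ.agv i with
    | some a => .agent a
    | none => .var (.agentV i)
  | .var (.nonceV i j) =>
    match σ.nov i j with
    | some (a, j', s) => .nonce a j' s
    | none => .var (.nonceV i j)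
  | .var (.cipherV i) => (σ.civ i).getD (.var (.cipherV i))
  | .var (.sigV i) => (σ.siv i).getD (.var (.sigV i))
  | .agent a => .agent a
  | .ek a => .ek (σ.applyA a)
  | .dk a => .dk (σ.applyA a)
  | .sk a => .sk (σ.applyA a)
  | .vk a => .vk (σ.applyA a)
  | .nonce a j s => .nonce a j s
  | .pair t₁ t₂ => .pair (σ.apply t₁) (σ.apply t₂)
  | .enc a t l => .enc (σ.applyA a) (σ.apply t) (σ.applyLb l)
  | .sign a t l => .sign (σ.applyA a) (σ.apply t) (σ.applyLb l)

/-- The erased substitution `|σ|`, with `|σ|(X) = |σ(X)|` (label variables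
disappear under erasure). -/
def eraseSubst (σ : Subst) : Subst :=
  { agv := σ.agv
    nov := σ.nov
    civ := fun i => (σ.civ i).map erase
    siv := fun i => (σ.siv i).map erase
    lbv := fun _ => none }

def Subst.union (σ θ : Subst) : Subst :=
  { agv := fun i => (σ.agv i).orElse fun _ => θ.agv i
    nov := fun i j => (σ.nov i j).orElse fun _ => θ.nov i j
    civ := fun i => (σ.civ i).orElse fun _ => θ.civ i
    siv := fun i => (σ.siv i).orElse fun _ => θ.siv i
    lbv := fun i => (σ.lbv i).orElse fun _ => θ.lbv i }

def Subst.empty : Subst :=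
  ⟨fun _ => none, fun _ _ => none, fun _ => none, fun _ => none, fun _ => none⟩

/-! ## The execution model -/

/-- Session identifiers `(n, j, (a_1, ..., a_k))`. -/
abbrev SessionId := ℕ × ℕ × List ℕ

/-- Local states `(σ, i, p)`. -/
abbrev LState := Subst × ℕ × ℕ

/-- Global states `(SId, f, H)` (the corrupted agents of the initial corrupt
action, if any, are recorded in the state). -/
structure GState where
  sids : List SessionId
  f : SessionId → Option LState
  H : Set Term
  corrupted : List ℕ

/-- A protocol maps each role index to a sequence of
(expected pattern, response) pairs; `none` stands for `init` / `stop`. -/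
abbrev Protocol := ℕ → List (Option Term × Option Term)

/-- Symbolic execution traces (most recent global state first). -/
abbrev Trace := List GState

/-- The knowledge of an agent: its secret keys and its nonces. -/
def kn (a : ℕ) : Set Term :=
  {t | t = .dk (.const a) ∨ t = .sk (.const a) ∨ ∃ j s, t = .nonce a j s}

def initG : GState := ⟨[], fun _ => none, ∅, []⟩

def corruptG (as : List ℕ) : GState :=
  { initG with H := {t | ∃ a ∈ as, t ∈ kn a}, corrupted := as }

/-- The initial partial substitution of a new session of role `i` with agents
`as` and session number `s`: agent variables are instantiated to the agents,
and the nonce variables of role `i` to fresh nonces `n(a_i, j, s)`. -/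
def initSubst (i : ℕ) (as : List ℕ) (s : ℕ) : Subst :=
  { agv := fun j => as[j-1]?
    nov := fun i' j => if i' = i then (as[i-1]?).map (fun a => (a, j, s)) else none
    civ := fun _ => none
    siv := fun _ => none
    lbv := fun _ => none }

def newG (g : GState) (i : ℕ) (as : List ℕ) : GState :=
  let s := g.sids.length + 1
  { g with
    sids := (s, i, as) :: g.sids
    f := Function.update g.f (s, i, as) (some (initSubst i as s, i, 1)) }

/-- `MatchPat σ θ lp m`: the message `m` matches the (optional) pattern `lp`
instantiated by `σ`, via the substitution `θ`. -/
def MatchPat (σ θ : Subst) (lp : Option Term) (m : Term) : Prop :=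
  match lp with
  | some l => m = θ.apply (σ.apply l)
  | none => θ = Subst.empty

def sendG (g : GState) (sid : SessionId) (σ : Subst) (j p : ℕ)
    (rr : Option Term) (θ : Subst) : GState :=
  { g with
    f := Function.update g.f sid (some (σ.union θ, j, p+1))
    H := match rr with
         | some r => insert (θ.apply (σ.apply r)) g.H
         | none => g.H }

def CanMatch (P : Protocol) (g : GState) (sid : SessionId) (m : Term) : Prop :=
  ∃ σ j p lp rr θ,
    g.f sid = some (σ, j, p) ∧ (P j)[p-1]? = some (lp, rr) ∧ MatchPat σ θ lp m

/-- The effect of a `send(sid, m)` transition: either the message matches the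
expected pattern and the session advances, or the state is left unchanged. -/
inductive SendStep (P : Protocol) (g : GState) (sid : SessionId) (m : Term) :
    GState → Prop
  | succ {σ : Subst} {j p : ℕ} {lp rr : Option Term} {θ : Subst} :
      g.f sid = some (σ, j, p) → (P j)[p-1]? = some (lp, rr) →
      MatchPat σ θ lp m → SendStep P g sid m (sendG g sid σ j p rr θ)
  | fail : ¬ CanMatch P g sid m → SendStep P g sid m g

/-- Valid execution traces of protocol `P` with respect to a deduction relation
`D` : every adversary-sent message must be deducible (by `D`) from the current
knowledge, and a corrupt action may occur only as first transition. -/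
inductive ExecD (D : Set Term → Term → Prop) (P : Protocol) : Trace → Prop
  | start : ExecD D P [initG]
  | corrupt (as : List ℕ) : ExecD D P [corruptG as, initG]
  | new {tr : Trace} {g : GState} (i : ℕ) (as : List ℕ) :
      ExecD D P (g :: tr) → ExecD D P (newG g i as :: g :: tr)
  | send {tr : Trace} {g g' : GState} (sid : SessionId) (m : Term) :
      ExecD D P (g :: tr) → D g.H m → SendStep P g sid m g' →
      ExecD D P (g' :: g :: tr)

/-- `tr ∈ Exec(Π)` for the labeled model. -/
def LExec (P : Protocol) : Trace → Prop := ExecD LDeduce P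

/-- `tr ∈ Exec(Π)` for the unlabeled model. -/
def UExec (P : Protocol) : Trace → Prop := ExecD UDeduce P

/-- Erasure of global states. -/
def eraseState (g : GState) : GState :=
  { sids := g.sids
    f := fun s => (g.f s).map fun x => (eraseSubst x.1, x.2.1, x.2.2)
    H := erase '' g.H
    corrupted := g.corrupted }

/-- Erasure of traces. -/
def eraseTrace : Trace → Trace := List.map eraseState

/-- Erasure of protocols. -/
def eraseProt (P : Protocol) : Protocol :=
  fun i => (P i).map fun x => (x.1.map erase, x.2.map erase)

/-! ## The security logic -/

/-- Agent expressions of the extended term algebra `T_Sub`: identities or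
meta-substitution variables applied to agent variables. -/
inductive SAgentE where
  | const : ℕ → SAgentE
  | svar : ℕ → ℕ → SAgentE        -- ς_k(A_i)
deriving DecidableEq

inductive SLabel where
  | ag : ℕ → SLabel
  | adv : ℕ → SLabel
  | svar : ℕ → ℕ → SLabel         -- ς_k(x_l)
deriving DecidableEq

/-- Terms of the extended algebra `T_Sub^l`, with applications `ς_k(x)` of
meta-variables for substitutions to object variables. -/
inductive STerm where
  | svar : ℕ → Var → STerm        -- ς_k(x)
  | agent : ℕ → STerm
  | ek : SAgentE → STerm
  | dk : SAgentE → STerm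
  | sk : SAgentE → STerm
  | vk : SAgentE → STerm
  | nonce : ℕ → ℕ → ℕ → STerm
  | pair : STerm → STerm → STerm
  | enc : SAgentE → STerm → Option SLabel → STerm
  | sign : SAgentE → STerm → Option SLabel → STerm
deriving DecidableEq

def evalA (η : ℕ → Subst) : SAgentE → AgentE
  | .const a => .const a
  | .svar k i =>
    match (η k).agv i with
    | some a => .const a
    | none => .avar i

def evalLb (η : ℕ → Subst) : Option SLabel → Option Label
  | none => none
  | some (.ag i) => some (.ag i)
  | some (.adv i) => some (.adv i)
  | some (.svar k n) =>
    match (η k).lbv n with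
    | some l => some l
    | none => some (.lvar n)

/-- Interpretation of an extended term under an assignment `η` of the
meta-variables for substitutions. -/
def evalT (η : ℕ → Subst) : STerm → Term
  | .svar k x => (η k).apply (.var x)
  | .agent a => .agent a
  | .ek a => .ek (evalA η a)
  | .dk a => .dk (evalA η a)
  | .sk a => .sk (evalA η a)
  | .vk a => .vk (evalA η a)
  | .nonce a j s => .nonce a j s
  | .pair t₁ t₂ => .pair (evalT η t₁) (evalT η t₂)
  | .enc a t l => .enc (evalA η a) (evalT η t) (evalLb η l)
  | .sign a t l => .sign (evalA η a) (evalT η t) (evalLb η l)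

/-- Erasure on extended terms (`|ς(x)| = ς(x)`). -/
def eraseST : STerm → STerm
  | .svar k x => .svar k x
  | .agent a => .agent a
  | .ek a => .ek a
  | .dk a => .dk a
  | .sk a => .sk a
  | .vk a => .vk a
  | .nonce a j s => .nonce a j s
  | .pair t₁ t₂ => .pair (eraseST t₁) (eraseST t₂)
  | .enc a t _ => .enc a (eraseST t) none
  | .sign a t _ => .sign a (eraseST t) none

/-- Erasure of assignments of the substitution meta-variables. -/
def eraseEnv (η : ℕ → Subst) : ℕ → Subst := fun k => eraseSubst (η k)

/-- Formulas of the logic `L1` (labeled: `L1^l`; the unlabeled logic `L1` is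
obtained over erased terms).  `fa i p k F` is `∀LS_{i,p}(tr) ς_k. F` and
`ex i p k F` is `∃LS_{i,p}(tr) ς_k. F`. -/
inductive Formula where
  | nc : STerm → Formula
  | eq : STerm → STerm → Formula
  | not : Formula → Formula
  | and : Formula → Formula → Formula
  | or : Formula → Formula → Formula
  | fa : ℕ → ℕ → ℕ → Formula → Formula
  | ex : ℕ → ℕ → ℕ → Formula → Formula

/-- Erasure of formulas. -/
def eraseF : Formula → Formula
  | .nc t => .nc (eraseST t)
  | .eq t₁ t₂ => .eq (eraseST t₁) (eraseST t₂)
  | .not F => .not (eraseF F)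
  | .and F₁ F₂ => .and (eraseF F₁) (eraseF F₂)
  | .or F₁ F₂ => .or (eraseF F₁) (eraseF F₂)
  | .fa i p k F => .fa i p k (eraseF F)
  | .ex i p k F => .ex i p k (eraseF F)

/-- The local states `LS_{i,p}(tr)` for role `i` at control point `p`
occurring in the trace `tr` (their substitution components). -/
def LS (i p : ℕ) (tr : Trace) : Set Subst :=
  {σ | ∃ g ∈ tr, ∃ s, g.f s = some (σ, i, p)}

/-- Interpretation of `NC(tr, t)`: `t` denotes an agent identity that does not
appear in the (initial) corrupt action of `tr`. -/
def NCsem (tr : Trace) (η : ℕ → Subst) (t : STerm) : Prop :=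
  ∃ a, evalT η t = .agent a ∧ ∀ g ∈ tr, a ∉ g.corrupted

/-- Semantics `⟦F(tr)⟧ = 1` of formulas (under an assignment `η` of the
substitution meta-variables; equality is syntactic). -/
def Sem (tr : Trace) : Formula → (ℕ → Subst) → Prop
  | .nc t, η => NCsem tr η t
  | .eq t₁ t₂, η => evalT η t₁ = evalT η t₂
  | .not F, η => ¬ Sem tr F η
  | .and F₁ F₂, η => Sem tr F₁ η ∧ Sem tr F₂ η
  | .or F₁ F₂, η => Sem tr F₁ η ∨ Sem tr F₂ η
  | .fa i p k F, η => ∀ θ ∈ LS i p tr, Sem tr F (Function.update η k θ)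
  | .ex i p k F, η => ∃ θ ∈ LS i p tr, Sem tr F (Function.update η k θ)

/-- `Π ⊨ φ` in the labeled model. -/
def LSat (P : Protocol) (φ : Formula) : Prop :=
  ∀ tr, LExec P tr → ∀ η, Sem tr φ η

/-- `Π ⊨ φ` in the unlabeled model. -/
def USat (P : Protocol) (φ : Formula) : Prop :=
  ∀ tr, UExec P tr → ∀ η, Sem tr φ η

/-- Simple extended terms: meta-variables applied to agent or nonce variables,
agent identities, and nonces. -/
inductive STerm.Simple : STerm → Prop
  | agv (k i : ℕ) : STerm.Simple (.svar k (.agentV i))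
  | nov (k i j : ℕ) : STerm.Simple (.svar k (.nonceV i j))
  | agent (a : ℕ) : STerm.Simple (.agent a)
  | nonce (a j s : ℕ) : STerm.Simple (.nonce a j s)

/-- The fragment `L2` (`L2^l`): no arbitrary negation, inequality tests between
arbitrary terms, equality tests between simple terms only. -/
inductive IsL2 : Formula → Prop
  | nc (t : STerm) : IsL2 (.nc t)
  | nnc (t : STerm) : IsL2 (.not (.nc t))
  | and {F₁ F₂ : Formula} : IsL2 F₁ → IsL2 F₂ → IsL2 (.and F₁ F₂)
  | or {F₁ F₂ : Formula} : IsL2 F₁ → IsL2 F₂ → IsL2 (.or F₁ F₂)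
  | neq (t₁ t₂ : STerm) : IsL2 (.not (.eq t₁ t₂))
  | eq {u₁ u₂ : STerm} : u₁.Simple → u₂.Simple → IsL2 (.eq u₁ u₂)
  | fa (i p k : ℕ) {F : Formula} : IsL2 F → IsL2 (.fa i p k F)
  | ex (i p k : ℕ) {F : Formula} : IsL2 F → IsL2 (.ex i p k F)

end Proto

namespace Proto

/-- The nonce variable `X^1_{A_1}`. -/
def nX : Term := .var (.nonceV 1 1)

/-- `Π(1)`'s response:
`{⟨X^1_{A1}, ⟨{X^1_{A1}}_{ek(A3)}^{ag(1)}, {X^1_{A1}}_{ek(A3)}^{ag(2)}⟩⟩}_{ek(A2)}^{ag(3)}`. -/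
def respA : Term :=
  .enc (.avar 2)
    (.pair nX (.pair (.enc (.avar 3) nX (some (.ag 1)))
                     (.enc (.avar 3) nX (some (.ag 2)))))
    (some (.ag 3))

/-- `Π(2)`'s expected pattern:
`{⟨X^1_{A1}, ⟨C^1_{A2}, C^2_{A2}⟩⟩}_{ek(A2)}^L`. -/
def pattB : Term :=
  .enc (.avar 2) (.pair nX (.pair (.var (.cipherV 1)) (.var (.cipherV 2))))
    (some (.lvar 0))

/-- The two-role counterexample protocol:
`Π(1) = (init, respA)` and `Π(2) = (pattB, stop)`. -/
def exProt : Protocol := fun i =>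
  if i = 1 then [(none, some respA)]
  else if i = 2 then [(some pattB, none)]
  else []

end Proto

namespace Proto

/-- The `L1^l` formula
`φ1(tr) = ∀LS_{1,2}(tr) ς. ∀LS_{2,2}(tr) ς'.
  (NC(tr, ς(A1)) ∧ NC(tr, ς(A2)) ∧ (ς(X^1_{A1}) = ς'(X^1_{A1})))
    → (ς'(C^1_{A2}) = ς'(C^2_{A2}))`,
with the implication `φ → ψ` written as `¬φ ∨ ψ`. -/
def phi1 : Formula :=
  .fa 1 2 0 (.fa 2 2 1
    (.or
      (.not (.and (.and (.nc (.svar 0 (.agentV 1))) (.nc (.svar 0 (.agentV 2))))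
                  (.eq (.svar 0 (.nonceV 1 1)) (.svar 1 (.nonceV 1 1)))))
      (.eq (.svar 1 (.cipherV 1)) (.svar 1 (.cipherV 2)))))

theorem UDeduce.mono {S T : Set Term} (h : S ⊆ T) {m : Term} (d : UDeduce S m) : UDeduce T m := by
  induction d with
  | mem hm => exact .mem (h hm)
  | agentK b => exact .agentK _ b
  | ekK b => exact .ekK _ b
  | vkK b => exact .vkK _ b
  | pairI _ _ i1 i2 => exact .pairI i1 i2
  | fstE _ i1 => exact .fstE i1
  | sndE _ i1 => exact .sndE i1
  | encI _ _ i1 i2 => exact .encI i1 i2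
  | decI _ _ i1 i2 => exact .decI i1 i2
  | signI _ _ i1 i2 => exact .signI i1 i2
  | signE _ i1 => exact .signE i1

/-- Terms protecting the nonce `n` under the public key of `a2`. -/
def Prot (n : Term) (a2 : ℕ) : Term → Prop
  | .dk a => a ≠ .const a2
  | .nonce a j s => Term.nonce a j s ≠ n
  | .pair t₁ t₂ => Prot n a2 t₁ ∧ Prot n a2 t₂
  | .enc b m _ => Prot n a2 m ∨ (b = .const a2 ∧ ∃ C, m = .pair n (.pair C C))
  | .sign _ m _ => Prot n a2 m
  | _ => True

theorem Prot.deduce {n : Term} {a2 : ℕ} {S : Set Term} (h : ∀ t ∈ S, Prot n a2 t) {m : Term}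
    (d : UDeduce S m) : Prot n a2 m := by
  induction d with
  | mem hm => exact h _ hm
  | agentK b => trivial
  | ekK b => trivial
  | vkK b => trivial
  | pairI _ _ i1 i2 => exact ⟨i1, i2⟩
  | fstE _ i1 => exact i1.1
  | sndE _ i1 => exact i1.2
  | encI _ _ i1 i2 => exact Or.inl i2
  | decI _ _ i1 i2 =>
    rcases i1 with h1 | h1
    · exact h1
    · exact absurd h1.1 i2
  | signI _ _ i1 i2 => exact i2
  | signE _ i1 => exact i1

theorem union_empty (σ : Subst) : σ.union Subst.empty = σ := by
  obtain ⟨a, b, c, d, e⟩ := σ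
  simp only [Subst.union, Subst.empty, Subst.mk.injEq]
  refine ⟨?_, ?_, ?_, ?_, ?_⟩
  · funext i; cases a i <;> rfl
  · funext i j; cases b i j <;> rfl
  · funext i; cases c i <;> rfl
  · funext i; cases d i <;> rfl
  · funext i; cases e i <;> rfl

theorem applyA_empty (a : AgentE) : Subst.empty.applyA a = a := by
  cases a <;> rfl

theorem apply_empty (t : Term) : Subst.empty.apply t = t := by
  induction t with
  | var x => cases x <;> rfl
  | pair _ _ h1 h2 => simp [Subst.apply, h1, h2]
  | enc a t l h =>
    simp only [Subst.apply, h, applyA_empty]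
    rcases l with _ | (_ | _ | _) <;> rfl
  | sign a t l h =>
    simp only [Subst.apply, h, applyA_empty]
    rcases l with _ | (_ | _ | _) <;> rfl
  | _ => simp [Subst.apply, applyA_empty]

/-- Invariant of the unlabeled executions. -/
structure Inv (g : GState) (tr : Trace) : Prop where
  dom : ∀ g' ∈ g :: tr, ∀ sid x, g'.f sid = some x → ∃ y, g.f sid = some y
  le : ∀ sid x, g.f sid = some x → sid.1 ≤ g.sids.length
  uniq : ∀ sid sid' x y, g.f sid = some x → g.f sid' = some y → sid.1 = sid'.1 → sid = sid'
  loc : ∀ g' ∈ g :: tr, ∀ s i as σ j p, g'.f (s, i, as) = some (σ, j, p) →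
    j = i ∧ (j = 1 → σ = initSubst 1 as s) ∧
      ((p = 1 ∧ σ = initSubst j as s) ∨
       (p = 2 ∧ (j = 2 → ∃ b, UDeduce g.H (.enc b (.pair (σ.apply nX)
          (.pair (σ.apply (.var (.cipherV 1))) (σ.apply (.var (.cipherV 2))))) none))))
  hH : ∀ t ∈ g.H, (∃ a ∈ g.corrupted, t ∈ kn a) ∨
    ∃ s as x, g.f (s, 1, as) = some x ∧ t = (initSubst 1 as s).apply (erase respA)

theorem inv_exec {tr : Trace} (h : UExec (eraseProt exProt) tr) :
    ∃ g tr', tr = g :: tr' ∧ Inv g tr' := by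
  unfold UExec at h
  induction h with
  | start =>
    refine ⟨_, _, rfl, ?_, ?_, ?_, ?_, ?_⟩ <;> simp [initG]
  | corrupt as =>
    refine ⟨_, _, rfl, ?_, ?_, ?_, ?_, ?_⟩ <;> simp [initG, corruptG]
  | @new tr g i as h ih =>
    obtain ⟨_, _, e, I⟩ := ih
    cases e
    have hf : ∀ sid y, g.f sid = some y → (newG g i as).f sid = some y := by
      intro sid y hy
      have := I.le _ _ hy
      simp only [newG]
      rw [Function.update_of_ne, hy]
      rintro rfl
      simp at this
    have hf' : ∀ sid y, (newG g i as).f sid = some y → g.f sid = some y ∨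
        (sid = (g.sids.length + 1, i, as) ∧
          y = (initSubst i as (g.sids.length + 1), i, 1)) := by
      intro sid y hy
      simp only [newG, Function.update_apply] at hy
      split at hy
      · right; simp_all
      · left; exact hy
    refine ⟨_, _, rfl, ?_, ?_, ?_, ?_, ?_⟩
    · intro g' hg' sid x hx
      rcases List.mem_cons.1 hg' with rfl | hg'
      · exact ⟨x, hx⟩
      · obtain ⟨y, hy⟩ := I.dom g' hg' sid x hx
        exact ⟨y, hf _ _ hy⟩
    · intro sid x hx
      rcases hf' _ _ hx with h1 | ⟨rfl, _⟩
      · have := I.le _ _ h1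
        simp only [newG, List.length_cons]; omega
      · simp [newG]
    · intro sid sid' x y hx hy hs
      rcases hf' _ _ hx with h1 | ⟨rfl, _⟩ <;> rcases hf' _ _ hy with h2 | ⟨rfl, _⟩
      · exact I.uniq _ _ _ _ h1 h2 hs
      · have := I.le _ _ h1
        simp only at hs; omega
      · have := I.le _ _ h2
        simp only at hs; omega
      · rfl
    · intro g' hg' s i' as' σ j p hx
      rcases List.mem_cons.1 hg' with rfl | hg'
      · rcases hf' _ _ hx with h1 | ⟨h1, h2⟩
        · exact I.loc g List.mem_cons_self _ _ _ _ _ _ h1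
        · cases h1; cases h2
          exact ⟨rfl, fun h => by rw [h], Or.inl ⟨rfl, rfl⟩⟩
      · exact I.loc g' hg' _ _ _ _ _ _ hx
    · intro t ht
      rcases I.hH t ht with h1 | ⟨s, as', x, h1, h2⟩
      · exact Or.inl h1
      · exact Or.inr ⟨s, as', x, hf _ _ h1, h2⟩
  | @send tr g g' sid m h hd hs ih =>
    obtain ⟨_, _, e, I⟩ := ih
    cases e
    cases hs with
    | fail _ =>
      refine ⟨_, _, rfl, ?_, I.le, I.uniq, ?_, I.hH⟩
      · intro g' hg'
        exact I.dom g' (by simpa using hg')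
      · intro g' hg'
        exact I.loc g' (by simpa using hg')
    | @succ σ j p lp rr θ h1 h2 h3 =>
      obtain ⟨s, i, as⟩ := sid
      obtain ⟨rfl, hj1, hp⟩ := I.loc g List.mem_cons_self _ _ _ _ _ _ h1
      have hP : p = 1 ∧ ((j = 1 ∧ lp = none ∧ rr = some (erase respA)) ∨
          (j = 2 ∧ lp = some (erase pattB) ∧ rr = none)) := by
        by_cases e1 : j = 1
        · subst e1
          rcases hp with ⟨rfl, _⟩ | ⟨rfl, _⟩
          · simp [eraseProt, exProt] at h2
            simp [h2]
          · simp [eraseProt, exProt] at h2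
        · by_cases e2 : j = 2
          · subst e2
            rcases hp with ⟨rfl, _⟩ | ⟨rfl, _⟩
            · simp [eraseProt, exProt] at h2
              simp [h2]
            · simp [eraseProt, exProt] at h2
          · simp [eraseProt, exProt, e1, e2] at h2
      obtain ⟨rfl, hP⟩ := hP
      have hσ : σ = initSubst j as s := by
        rcases hp with h | h
        · exact h.2
        · exact absurd h.1 (by decide)
      have hsub : g.H ⊆ (sendG g (s, j, as) σ j 1 rr θ).H := by
        cases rr with
        | none => exact fun _ h => h
        | some r => exact Set.subset_insert _ _
      have hf : ∀ sid y, g.f sid = some y →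
          ∃ z, (sendG g (s, j, as) σ j 1 rr θ).f sid = some z := by
        intro sid y hy
        simp only [sendG, Function.update_apply]
        split
        · exact ⟨_, rfl⟩
        · exact ⟨y, hy⟩
      have hf' : ∀ sid y, (sendG g (s, j, as) σ j 1 rr θ).f sid = some y →
          (sid = (s, j, as) ∧ y = (σ.union θ, j, 2)) ∨ g.f sid = some y := by
        intro sid y hy
        simp only [sendG, Function.update_apply] at hy
        split at hy
        · left; simp_all
        · right; exact hy
      have hf'' : ∀ sid y, (sendG g (s, j, as) σ j 1 rr θ).f sid = some y →
          ∃ z, g.f sid = some z := by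
        intro sid y hy
        rcases hf' _ _ hy with ⟨rfl, _⟩ | h
        · exact ⟨_, h1⟩
        · exact ⟨_, h⟩
      have hloc : ∀ g' ∈ g :: tr, ∀ s' i' as' σ' j' p', g'.f (s', i', as') = some (σ', j', p') →
          j' = i' ∧ (j' = 1 → σ' = initSubst 1 as' s') ∧
          ((p' = 1 ∧ σ' = initSubst j' as' s') ∨
          (p' = 2 ∧ (j' = 2 → ∃ b, UDeduce (sendG g (s, j, as) σ j 1 rr θ).H
          (.enc b (.pair (σ'.apply nX)
          (.pair (σ'.apply (.var (.cipherV 1))) (σ'.apply (.var (.cipherV 2))))) none)))) := by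
        intro g' hg' s' i' as' σ' j' p' hx
        obtain ⟨a1, a2, a3⟩ := I.loc g' hg' _ _ _ _ _ _ hx
        refine ⟨a1, a2, a3.imp id fun a3 => ⟨a3.1, fun e => ?_⟩⟩
        obtain ⟨b, hb⟩ := a3.2 e
        exact ⟨b, hb.mono hsub⟩
      refine ⟨_, _, rfl, ?_, ?_, ?_, ?_, ?_⟩
      · intro g' hg' sid x hx
        rcases List.mem_cons.1 hg' with rfl | hg'
        · exact ⟨x, hx⟩
        · obtain ⟨y, hy⟩ := I.dom g' hg' sid x hx
          exact hf _ _ hy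
      · intro sid x hx
        obtain ⟨z, hz⟩ := hf'' _ _ hx
        exact I.le _ _ hz
      · intro sid sid' x y hx hy
        obtain ⟨z, hz⟩ := hf'' _ _ hx
        obtain ⟨w, hw⟩ := hf'' _ _ hy
        exact I.uniq _ _ _ _ hz hw
      · intro g' hg' s' i' as' σ' j' p' hx
        rcases List.mem_cons.1 hg' with rfl | hg'
        · rcases hf' _ _ hx with ⟨e1, e2⟩ | h
          · cases e1; cases e2
            refine ⟨rfl, ?_, Or.inr ⟨rfl, ?_⟩⟩
            · rintro rfl
              rcases hP with ⟨_, rfl, _⟩ | ⟨h, _⟩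
              · have : θ = Subst.empty := h3
                rw [this, union_empty, hσ]
              · exact absurd h (by decide)
            · rintro rfl
              rcases hP with ⟨h, _⟩ | ⟨_, rfl, rfl⟩
              · exact absurd h (by decide)
              · have h3 : m = _ := h3
                refine ⟨θ.applyA (σ.applyA (.avar 2)), ?_⟩
                have hm : m = .enc (θ.applyA (σ.applyA (.avar 2)))
                    (.pair ((σ.union θ).apply nX)
                      (.pair ((σ.union θ).apply (.var (.cipherV 1)))
                        ((σ.union θ).apply (.var (.cipherV 2))))) none := by
                  rw [h3, hσ]
                  simp [pattB, nX, erase, Subst.apply, initSubst, Subst.union, Subst.applyLb]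
                rw [← hm]
                exact hd.mono hsub
          · exact hloc g List.mem_cons_self _ _ _ _ _ _ h
        · exact hloc g' hg' _ _ _ _ _ _ hx
      · intro t ht
        have key : t ∈ g.H → (∃ a ∈ (sendG g (s, j, as) σ j 1 rr θ).corrupted, t ∈ kn a) ∨
            ∃ s' as' x, (sendG g (s, j, as) σ j 1 rr θ).f (s', 1, as') = some x ∧
              t = (initSubst 1 as' s').apply (erase respA) := by
          intro ht
          rcases I.hH t ht with h1 | ⟨s, as', x, h1, h2⟩
          · exact Or.inl h1
          · obtain ⟨z, hz⟩ := hf _ _ h1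
            exact Or.inr ⟨_, _, z, hz, h2⟩
        rcases hP with ⟨rfl, rfl, rfl⟩ | ⟨rfl, rfl, rfl⟩
        · have : θ = Subst.empty := h3
          subst this
          rcases ht with ht | ht
          · obtain ⟨z, hz⟩ := hf _ _ h1
            right
            refine ⟨s, as, z, hz, ?_⟩
            rw [ht, apply_empty, hσ]
          · exact key ht
        · exact key ht

theorem usat_ex : USat (eraseProt exProt) (eraseF phi1) := by
  intro tr htr η
  obtain ⟨g, tr', rfl, I⟩ := inv_exec htr
  simp only [phi1, eraseF, eraseST, Sem, NCsem, evalT]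
  rintro σ ⟨g1, hg1, ⟨s, i, as⟩, hσ⟩ σ' ⟨g2, hg2, ⟨s', i', as'⟩, hσ'⟩
  rw [← imp_iff_not_or]
  simp only [Function.update_self, Function.update_of_ne (show (0 : ℕ) ≠ 1 by decide)]
  rintro ⟨⟨⟨a1, ha1, hc1⟩, ⟨a2, ha2, hc2⟩⟩, heq⟩
  obtain ⟨rfl, h1, -⟩ := I.loc g1 hg1 _ _ _ _ _ _ hσ
  have h1 := h1 rfl
  obtain ⟨rfl, -, h2⟩ := I.loc g2 hg2 _ _ _ _ _ _ hσ'
  obtain ⟨b, hb⟩ : ∃ b, UDeduce g.H (.enc b (.pair (σ'.apply nX)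
          (.pair (σ'.apply (.var (.cipherV 1))) (σ'.apply (.var (.cipherV 2))))) none) := by
    rcases h2 with ⟨h, _⟩ | ⟨_, h⟩
    · exact absurd h (by decide)
    · exact h rfl
  have hc1 := hc1 g List.mem_cons_self
  have hc2 := hc2 g List.mem_cons_self
  obtain ⟨z, hz⟩ := I.dom g1 hg1 _ _ hσ
  subst h1
  have e1 : as[0]? = some a1 := by
    cases h : as[0]? <;> simp_all [Subst.apply, initSubst]
  have e2 : as[1]? = some a2 := by
    cases h : as[1]? <;> simp_all [Subst.apply, initSubst]
  have en : σ'.apply nX = .nonce a1 1 s := by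
    rw [nX, ← heq]
    simp [Subst.apply, initSubst, e1]
  rw [en] at hb
  have hp : ∀ t ∈ g.H, Prot (.nonce a1 1 s) a2 t := by
    intro t ht
    rcases I.hH t ht with ⟨a, ha, hk⟩ | ⟨s2, as2, x, hx, rfl⟩
    · rcases hk with rfl | rfl | ⟨j, s, rfl⟩
      · simp only [Prot, ne_eq, AgentE.const.injEq]
        rintro rfl; exact hc2 ha
      · trivial
      · simp only [Prot, ne_eq, Term.nonce.injEq]
        rintro ⟨rfl, _⟩; exact hc1 ha
    · by_cases es : s2 = s
      · have := I.uniq _ _ _ _ hx hz es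
        cases this
        right
        refine ⟨?_, .enc ((initSubst 1 as s).applyA (.avar 3)) (.nonce a1 1 s) none, ?_⟩
        · simp [Subst.applyA, initSubst, e2]
        · simp [erase, nX, Subst.apply, initSubst, e1, Subst.applyLb]
      · left
        cases h : as2[0]? <;>
          simp [erase, nX, Subst.apply, initSubst, h, Prot, es]
  rcases Prot.deduce hp hb with h | ⟨_, C, h⟩
  · exact absurd rfl h.1
  · simp only [Term.pair.injEq] at h
    rw [h.2.1, h.2.2]

/-- The matching substitution of the responder in the labeled attack trace. -/
def thetaB : Subst :=
  { agv := fun _ => none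
    nov := fun _ _ => some (1, 1, 1)
    civ := fun i => some (.enc (.const 3) (.nonce 1 1 1) (some (.ag i)))
    siv := fun _ => none
    lbv := fun _ => some (.ag 3) }

theorem not_lsat_ex : ¬ LSat exProt phi1 := by
  intro h
  let as : List ℕ := [1, 2, 3]
  let g2 := newG (newG initG 1 as) 2 as
  let g3 := sendG g2 (1, 1, as) (initSubst 1 as 1) 1 1 (some respA) Subst.empty
  let g4 := sendG g3 (2, 2, as) (initSubst 2 as 2) 2 1 none thetaB
  have t2 : ExecD LDeduce exProt [g2, newG initG 1 as, initG] := .new _ _ (.new _ _ .start)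
  have t3 : ExecD LDeduce exProt [g3, g2, newG initG 1 as, initG] := by
    refine .send (1, 1, as) (.agent 0) t2 (.agentK _ _) (.succ (lp := none) ?_ ?_ rfl)
    · simp [g2, newG, initG, Function.update_apply]
    · simp [exProt]
  have t4 : ExecD LDeduce exProt [g4, g3, g2, newG initG 1 as, initG] := by
    refine .send (2, 2, as) ((initSubst 1 as 1).apply respA) t3 (.mem ?_)
      (.succ (lp := some pattB) ?_ ?_ ?_)
    · left
      rw [apply_empty]
    · simp [g3, sendG, g2, newG, initG, Function.update_apply]
    · simp [exProt]
    · rfl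
  have := h _ t4 (fun _ => Subst.empty)
  simp only [phi1, Sem, NCsem, evalT] at this
  have := this (initSubst 1 as 1) ⟨g3, by simp, (1, 1, as), by
      simp [g3, sendG, union_empty]⟩
    ((initSubst 2 as 2).union thetaB) ⟨g4, by simp, (2, 2, as), by simp [g4, sendG]⟩
  rw [← imp_iff_not_or] at this
  simp only [Function.update_self, Function.update_of_ne (show (0 : ℕ) ≠ 1 by decide)] at this
  have := this ⟨⟨⟨1, rfl, ?_⟩, ⟨2, rfl, ?_⟩⟩, rfl⟩
  · simp [Subst.apply, Subst.union, thetaB, initSubst] at this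
  · simp [g4, g3, g2, sendG, newG, initG]
  · simp [g4, g3, g2, sendG, newG, initG]

/-- the soundness theorem fails for the full logic `L1^l`:
there are a labeled protocol `Π` and a closed formula `φ ∈ L1^l` with
`|Π| ⊨ |φ|` but `Π ⊭ φ`, witnessed by the concrete protocol `exProt` and the
concrete formula `phi1`. -/
theorem counterexample_L1 :
    (USat (eraseProt exProt) (eraseF phi1) ∧ ¬ LSat exProt phi1) ∧
    ∃ (P : Protocol) (φ : Formula), USat (eraseProt P) (eraseF φ) ∧ ¬ LSat P φ := by
  exact ⟨⟨usat_ex, not_lsat_ex⟩, exProt, phi1, usat_ex, not_lsat_ex⟩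

end Proto
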